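/- Let F be uniformly elliptic with constants 0 < λ ≤ Λ and let u solve the fully nonlinear obstacle problem in Ω with obstacle φ. Suppose 0 ∈ ∂{u > φ} (so u(0) = φ(0)), B_r(0) ⊂ Ω, and φ has modulus of continuity γ on B_r(0), i.e. |φ(x) − φ(y)| ≤ γ(|x − y|) for x, y ∈ B_r(0) with γ nondecreasing. Then there is a constant C depending only on n, λ, Λ such that u(x) − u(0) ≤ C·γ(r) for every x ∈ B_{r/4}(0); in particular, if φ is Lipschitz with constant L, then sup_{B_{r/4}(0)} (u − u(0)) ≤ C·L·r. -/

import Mathlib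

open MeasureTheory Metric Set
open scoped RealInnerProductSpace

noncomputable section

/-- Euclidean space ℝⁿ. -/
abbrev Euc (n : ℕ) := EuclideanSpace ℝ (Fin n)

/-- The operator norm of an `n × n` real matrix, viewed as a linear map on ℝⁿ. -/
def opNorm {n : ℕ} (A : Matrix (Fin n) (Fin n) ℝ) : ℝ :=
  ‖Matrix.toEuclideanCLM (𝕜 := ℝ) A‖

/-- The Hessian matrix `D²u(x)` of `u : ℝⁿ → ℝ` at `x`. -/
def hess2 {n : ℕ} (u : Euc n → ℝ) (x : Euc n) : Matrix (Fin n) (Fin n) ℝ :=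
  fun i j => iteratedFDeriv ℝ 2 u x ![EuclideanSpace.single i 1, EuclideanSpace.single j 1]

/-- `F` is uniformly elliptic with ellipticity constants `0 < lb ≤ ub`:
`lb‖P‖ ≤ F(A+P) − F(A) ≤ ub‖P‖` for all symmetric `A` and positive semidefinite `P`. -/
def UniformlyElliptic {n : ℕ} (F : Matrix (Fin n) (Fin n) ℝ → ℝ) (lb ub : ℝ) : Prop :=
  ∀ (A P : Matrix (Fin n) (Fin n) ℝ), A.IsSymm → P.PosSemidef →
    lb * opNorm P ≤ F (A + P) - F A ∧ F (A + P) - F A ≤ ub * opNorm P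

/-- `u` is a viscosity supersolution of `F(D²u) ≤ 0` in `U`: every C² test function
touching `u` from below at a point of `U` satisfies `F(D²ψ(x₀)) ≤ 0`. -/
def ViscSupersol {n : ℕ} (F : Matrix (Fin n) (Fin n) ℝ → ℝ) (U : Set (Euc n))
    (u : Euc n → ℝ) : Prop :=
  ∀ x₀ ∈ U, ∀ ψ : Euc n → ℝ, ContDiff ℝ 2 ψ → ψ x₀ = u x₀ →
    (∀ᶠ x in nhds x₀, ψ x ≤ u x) → F (hess2 ψ x₀) ≤ 0

/-- `u` is a viscosity subsolution of `F(D²u) ≥ 0` in `U`: every C² test function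
touching `u` from above at a point of `U` satisfies `F(D²ψ(x₀)) ≥ 0`. -/
def ViscSubsol {n : ℕ} (F : Matrix (Fin n) (Fin n) ℝ → ℝ) (U : Set (Euc n))
    (u : Euc n → ℝ) : Prop :=
  ∀ x₀ ∈ U, ∀ ψ : Euc n → ℝ, ContDiff ℝ 2 ψ → ψ x₀ = u x₀ →
    (∀ᶠ x in nhds x₀, u x ≤ ψ x) → 0 ≤ F (hess2 ψ x₀)

/-- `u` solves the fully nonlinear obstacle problem in `Ω` with obstacle `φ`:
`u ∈ C(Ω)`, `u ≥ φ` in `Ω`, `u` is a viscosity supersolution of `F(D²u) ≤ 0` in `Ω`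
and a viscosity solution of `F(D²u) = 0` in the non-contact set `{u > φ}`. -/
def SolvesObstacle {n : ℕ} (F : Matrix (Fin n) (Fin n) ℝ → ℝ) (Ω : Set (Euc n))
    (u φ : Euc n → ℝ) : Prop :=
  ContinuousOn u Ω ∧ (∀ x ∈ Ω, φ x ≤ u x) ∧ ViscSupersol F Ω u ∧
  ViscSupersol F {x ∈ Ω | φ x < u x} u ∧ ViscSubsol F {x ∈ Ω | φ x < u x} u

/-- A modulus: `ω : [0,∞) → [0,∞)` nondecreasing with `ω(0) = 0`. -/
def IsModulus (ω : ℝ → ℝ) : Prop :=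
  ω 0 = 0 ∧ MonotoneOn ω (Ici 0) ∧ ∀ r, 0 ≤ r → 0 ≤ ω r

/-- `φ` is semiconvex on `Ω` with modulus of semiconvexity `ω`: at every `x₀ ∈ Ω` there is
a slope `p` with `φ(x) ≥ φ(x₀) + ⟨p, x − x₀⟩ − ω(|x − x₀|)` on `Ω`. -/
def SemiconvexWithModulus {n : ℕ} (Ω : Set (Euc n)) (φ : Euc n → ℝ) (ω : ℝ → ℝ) : Prop :=
  ∀ x₀ ∈ Ω, ∃ p : Euc n, ∀ x ∈ Ω, φ x₀ + ⟪p, x - x₀⟫ - ω ‖x - x₀‖ ≤ φ x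

/-- `p` is the slope of a linear part of `φ` at `x₀` (for modulus `ω`). -/
def IsLinearPartSlope {n : ℕ} (Ω : Set (Euc n)) (φ : Euc n → ℝ) (ω : ℝ → ℝ)
    (x₀ : Euc n) (p : Euc n) : Prop :=
  ∀ x ∈ Ω, φ x₀ + ⟪p, x - x₀⟫ - ω ‖x - x₀‖ ≤ φ x

/-- `g` is semiconcave with modulus `ω` on `s`. -/
def SemiconcaveWithModulus {n : ℕ} (s : Set (Euc n)) (g : Euc n → ℝ) (ω : ℝ → ℝ) : Prop :=
  ∀ x h : Euc n, x ∈ s → x + h ∈ s → x - h ∈ s →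
    g (x + h) + g (x - h) - 2 * g x ≤ ω ‖h‖

/-- Componentwise order `x ≤ y` on ℝⁿ (`y − x` in the positive cone). -/
def coneLE {n : ℕ} (x y : Euc n) : Prop := ∀ i, x i ≤ y i

/-- The intervention operator `Mu(x) = φ(x) + inf{ u(y) : y ∈ D, y ≥ x }`. -/
def Mop {n : ℕ} (D : Set (Euc n)) (φ u : Euc n → ℝ) (x : Euc n) : ℝ :=
  φ x + sInf (u '' {y ∈ D | coneLE x y})

/-- A bounded domain with `C^{2,α}` boundary, via a global `C^{2,α}` defining function. -/
def IsC2AlphaDomain {n : ℕ} (Ω : Set (Euc n)) (α : ℝ) : Prop :=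
  ∃ ρ : Euc n → ℝ, ContDiff ℝ 2 ρ ∧ Ω = {x | ρ x < 0} ∧
    (∀ x ∈ frontier Ω, fderiv ℝ ρ x ≠ 0) ∧
    ∃ C : ℝ, 0 ≤ C ∧ ∀ x y : Euc n,
      ‖iteratedFDeriv ℝ 2 ρ x - iteratedFDeriv ℝ 2 ρ y‖ ≤ C * ‖x - y‖ ^ α

/-- `u` is a continuous viscosity solution of the fully nonlinear stochastic impulse
control problem on `Ω` with obstacle `Mu` built from `φ`: `u ∈ C(Ω̄)`, `u ≤ Mu` in `Ω`,
`u` is a viscosity subsolution of `F(D²u) ≥ 0` in `Ω`, a viscosity solution of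
`F(D²u) = 0` in `{u < Mu}`, `u = 0` on `∂Ω` and `u ≤ 0` on `Ω̄`. -/
def SolvesImpulse {n : ℕ} (F : Matrix (Fin n) (Fin n) ℝ → ℝ) (Ω : Set (Euc n))
    (u φ : Euc n → ℝ) : Prop :=
  ContinuousOn u (closure Ω) ∧
  (∀ x ∈ Ω, u x ≤ Mop (closure Ω) φ u x) ∧
  ViscSubsol F Ω u ∧
  ViscSubsol F {x ∈ Ω | u x < Mop (closure Ω) φ u x} u ∧
  ViscSupersol F {x ∈ Ω | u x < Mop (closure Ω) φ u x} u ∧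
  (∀ x ∈ frontier Ω, u x = 0) ∧ (∀ x ∈ closure Ω, u x ≤ 0)

section Harnack

open Filter Topology Module

variable {E : Type*} [NormedAddCommGroup E] [InnerProductSpace ℝ E]

/-- The form of the supersolution property used in the Harnack inequality: `v` is nowhere touched
from below by a quadratic polynomial with Hessian `q ⊗ q - β I`, `κ β < |q|²`. -/
def NoConvexTouching (κ : ℝ) (U : Set E) (v : E → ℝ) : Prop :=
  ∀ x₀ ∈ U, ∀ p q : E, ∀ β : ℝ, 0 ≤ β → κ * β < ‖q‖ ^ 2 →
    ¬ ∀ᶠ x in 𝓝 x₀, v x₀ + ⟪p, x - x₀⟫ + (⟪q, x - x₀⟫ ^ 2 - β * ‖x - x₀‖ ^ 2) / 2 ≤ v x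

theorem NoConvexTouching.mono {κ : ℝ} {U V : Set E} {v : E → ℝ} (h : NoConvexTouching κ V v)
    (hUV : U ⊆ V) : NoConvexTouching κ U v :=
  fun x hx => h x (hUV hx)

/-- Invariance under affine changes of the dependent variable and homotheties. -/
theorem NoConvexTouching.rescale {κ : ℝ} {U : Set E} {v : E → ℝ} (h : NoConvexTouching κ U v)
    (c : E) {ρ s : ℝ} (hρ : 0 < ρ) (hs : 0 < s) (b : ℝ) :
    NoConvexTouching κ ((fun y => c + ρ • y) ⁻¹' U) (fun y => s * v (c + ρ • y) + b) := by
  intro y₀ hy₀ p q β hβ hq hev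
  refine h _ hy₀ ((s * ρ)⁻¹ • p) ((√s * ρ)⁻¹ • q) ((s * ρ ^ 2)⁻¹ * β) (by positivity) ?_ ?_
  · rw [norm_smul, mul_pow, Real.norm_eq_abs, sq_abs, inv_pow, mul_pow, Real.sq_sqrt hs.le]
    calc κ * ((s * ρ ^ 2)⁻¹ * β) = (s * ρ ^ 2)⁻¹ * (κ * β) := by ring
      _ < _ := by gcongr
  · have hcont : Tendsto (fun x : E => ρ⁻¹ • (x - c)) (𝓝 (c + ρ • y₀)) (𝓝 y₀) := by
      have : Continuous (fun x : E => ρ⁻¹ • (x - c)) := by fun_prop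
      convert this.tendsto (c + ρ • y₀) using 2
      simp [smul_smul, hρ.ne']
    filter_upwards [hcont.eventually hev] with x hx
    have e1 : c + ρ • ρ⁻¹ • (x - c) = x := by simp [smul_smul, hρ.ne']
    have e2 : ρ⁻¹ • (x - c) - y₀ = ρ⁻¹ • (x - (c + ρ • y₀)) := by
      simp only [smul_sub, smul_add, smul_smul, inv_mul_cancel₀ hρ.ne', one_smul]; abel
    simp only [e1, e2, inner_smul_right, norm_smul, mul_pow, Real.norm_eq_abs, sq_abs] at hx
    simp only [real_inner_smul_left, mul_pow, inv_pow, Real.sq_sqrt hs.le]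
    generalize ⟪p, x - (c + ρ • y₀)⟫ = A at *
    generalize ⟪q, x - (c + ρ • y₀)⟫ = B at *
    generalize ‖x - (c + ρ • y₀)‖ = D at *
    have : s * (v (c + ρ • y₀) + (s * ρ)⁻¹ * A + ((s)⁻¹ * (ρ ^ 2)⁻¹ * B ^ 2
        - (s * ρ ^ 2)⁻¹ * β * D ^ 2) / 2) ≤ s * v x := by
      have e : s * (v (c + ρ • y₀) + (s * ρ)⁻¹ * A + ((s)⁻¹ * (ρ ^ 2)⁻¹ * B ^ 2
        - (s * ρ ^ 2)⁻¹ * β * D ^ 2) / 2) = s * v (c + ρ • y₀) + ρ⁻¹ * A + ((ρ⁻¹) ^ 2 * B ^ 2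
          - β * ((ρ⁻¹) ^ 2 * D ^ 2)) / 2 := by
        field_simp
      rw [e]; linarith
    have := le_of_mul_le_mul_left this hs
    refine le_trans (le_of_eq ?_) this
    ring

/-- The minimum of a supersolution and a constant is a supersolution. -/
theorem NoConvexTouching.min_const {κ : ℝ} (hκ : 1 ≤ κ) {U : Set E} {v : E → ℝ} {c : ℝ}
    (h : NoConvexTouching κ (U ∩ {x | v x < c}) v) :
    NoConvexTouching κ U (fun x => min (v x) c) := by
  intro x₀ hx₀ p q β hβ hq hev
  rcases lt_or_ge (v x₀) c with hc | hc
  · refine h x₀ ⟨hx₀, hc⟩ p q β hβ hq ?_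
    filter_upwards [hev] with x hx
    simp only [min_eq_left hc.le] at hx
    exact hx.trans (min_le_left _ _)
  · have hq0 : 0 < ‖q‖ ^ 2 := lt_of_le_of_lt (by nlinarith) hq
    have hline : ∀ σ : ℝ, Tendsto (fun t : ℝ => x₀ + (σ * t) • q) (𝓝 0) (𝓝 x₀) := fun σ => by
      have : Continuous (fun t : ℝ => x₀ + (σ * t) • q) := by fun_prop
      simpa using this.tendsto 0
    have hpos : ∀ᶠ t : ℝ in 𝓝[>] 0, 0 < t := self_mem_nhdsWithin
    obtain ⟨t, ht, h1, h2⟩ := (hpos.and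
      ((((hline 1).eventually hev).and ((hline (-1)).eventually hev)).filter_mono
        nhdsWithin_le_nhds)).exists
    have h1' := h1.trans (min_le_right _ _)
    have h2' := h2.trans (min_le_right _ _)
    simp only [min_eq_right hc, add_sub_cancel_left, inner_smul_right, norm_smul, mul_pow,
      Real.norm_eq_abs, sq_abs, real_inner_self_eq_norm_sq] at h1' h2'
    have : t ^ 2 * ‖q‖ ^ 2 * (‖q‖ ^ 2 - β) ≤ 0 := by nlinarith
    have h3 : 0 < ‖q‖ ^ 2 - β := by nlinarith
    have : 0 < t ^ 2 * ‖q‖ ^ 2 * (‖q‖ ^ 2 - β) := by positivity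
    linarith

/-- A function on `[0, 1]` whose slope at `0` is larger than its slope at `1` has, after
subtracting an affine function, an interior maximum. -/
theorem exists_interior_tilted_max {f : ℝ → ℝ} {m₀ m m₁ C : ℝ} (hf : ContinuousOn f (Icc 0 1))
    (h₀ : ∀ t ∈ Icc (0 : ℝ) 1, f 0 + m₀ * t - C * t ^ 2 ≤ f t)
    (h₁ : ∀ t ∈ Icc (0 : ℝ) 1, f 1 - m₁ * (1 - t) - C * (1 - t) ^ 2 ≤ f t)
    (hm₀ : m < m₀) (hm₁ : m₁ < m) :
    ∃ t₀ ∈ Ioo (0 : ℝ) 1, ∀ t ∈ Icc (0 : ℝ) 1, f t - m * t ≤ f t₀ - m * t₀ := by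
  obtain ⟨t₀, ht₀, hmax⟩ := isCompact_Icc.exists_isMaxOn (nonempty_Icc.2 zero_le_one)
    (hf.sub (continuousOn_const.mul continuousOn_id) : ContinuousOn (fun t => f t - m * t) _)
  have hmax' : ∀ t ∈ Icc (0 : ℝ) 1, f t - m * t ≤ f t₀ - m * t₀ := fun t ht => hmax ht
  have small : ∀ δ : ℝ, 0 < δ → ∃ s ∈ Icc (0 : ℝ) 1, 0 < s ∧ C * s < δ := by
    intro δ hδ
    refine ⟨min 1 (δ / (2 * (|C| + 1))), ⟨by positivity, min_le_left _ _⟩, by positivity, ?_⟩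
    calc C * min 1 (δ / (2 * (|C| + 1)))
        ≤ (|C| + 1) * (δ / (2 * (|C| + 1))) := by
          apply mul_le_mul _ (min_le_right _ _) (by positivity) (by positivity)
          linarith [le_abs_self C]
      _ = δ / 2 := by field_simp
      _ < δ := by linarith
  refine ⟨t₀, ⟨lt_of_le_of_ne ht₀.1 ?_, lt_of_le_of_ne ht₀.2 ?_⟩, hmax'⟩
  · rintro rfl
    obtain ⟨s, hs, hs0, hsC⟩ := small (m₀ - m) (by linarith)
    have := hmax' s hs
    have := h₀ s hs
    nlinarith
  · rintro rfl
    obtain ⟨s, hs, hs0, hsC⟩ := small (m - m₁) (by linarith)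
    have hs' : 1 - s ∈ Icc (0 : ℝ) 1 := ⟨by linarith [hs.2], by linarith [hs.1]⟩
    have := hmax' _ hs'
    have := h₁ _ hs'
    ring_nf at *
    nlinarith

/-- Sliding paraboloids: the vertex of a paraboloid touching a supersolution from below is a
Lipschitz function of the contact point. -/
theorem dist_vertex_le_of_contact [FiniteDimensional ℝ E] {κ : ℝ} (hκ : 0 < κ) {u : E → ℝ}
    (hu : ContinuousOn u (closedBall 0 1)) (hS : NoConvexTouching κ (ball 0 1) u)
    {B : Set E} (hB : Convex ℝ B)
    (hint : ∀ z ∈ B, ∀ y ∈ closedBall (0 : E) 1,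
      (∀ x ∈ closedBall (0 : E) 1, u y + ‖y - z‖ ^ 2 / 2 ≤ u x + ‖x - z‖ ^ 2 / 2) →
        y ∈ ball (0 : E) 1)
    {z₁ z₂ y₁ y₂ : E} (hz₁ : z₁ ∈ B) (hz₂ : z₂ ∈ B) (hy₁ : y₁ ∈ closedBall (0 : E) 1)
    (hy₂ : y₂ ∈ closedBall (0 : E) 1)
    (hm₁ : ∀ x ∈ closedBall (0 : E) 1, u y₁ + ‖y₁ - z₁‖ ^ 2 / 2 ≤ u x + ‖x - z₁‖ ^ 2 / 2)
    (hm₂ : ∀ x ∈ closedBall (0 : E) 1, u y₂ + ‖y₂ - z₂‖ ^ 2 / 2 ≤ u x + ‖x - z₂‖ ^ 2 / 2) :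
    ‖z₁ - z₂‖ ≤ 2 * κ * ‖y₁ - y₂‖ := by
  have hex : ∀ z : E, ∃ y ∈ closedBall (0 : E) 1,
      ∀ x ∈ closedBall (0 : E) 1, u y + ‖y - z‖ ^ 2 / 2 ≤ u x + ‖x - z‖ ^ 2 / 2 := fun z =>
    (isCompact_closedBall (0 : E) 1).exists_isMinOn ⟨0, by simp⟩
      (hu.add (by fun_prop : Continuous fun y => ‖y - z‖ ^ 2 / 2).continuousOn)
  choose Y hYmem hYmin using hex
  have hexp : ∀ y z : E, ‖y - z‖ ^ 2 = ‖y‖ ^ 2 - 2 * ⟪y, z⟫ + ‖z‖ ^ 2 := fun y z =>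
    norm_sub_sq_real y z
  set h : E → ℝ := fun z => ⟪Y z, z⟫ - u (Y z) - ‖Y z‖ ^ 2 / 2 with hdef
  have hle : ∀ z, ∀ y ∈ closedBall (0 : E) 1, ⟪y, z⟫ - u y - ‖y‖ ^ 2 / 2 ≤ h z := by
    intro z y hy
    have := hYmin z y hy
    rw [hexp, hexp] at this
    simp only [hdef]; linarith
  have heq : ∀ z, ∀ y ∈ closedBall (0 : E) 1,
      (∀ x ∈ closedBall (0 : E) 1, u y + ‖y - z‖ ^ 2 / 2 ≤ u x + ‖x - z‖ ^ 2 / 2) →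
      h z = ⟪y, z⟫ - u y - ‖y‖ ^ 2 / 2 := by
    intro z y hy hm
    refine le_antisymm ?_ (hle z y hy)
    have := hm _ (hYmem z)
    rw [hexp, hexp] at this
    simp only [hdef]; linarith
  have hsub : ∀ z, ∀ y ∈ closedBall (0 : E) 1,
      (∀ x ∈ closedBall (0 : E) 1, u y + ‖y - z‖ ^ 2 / 2 ≤ u x + ‖x - z‖ ^ 2 / 2) →
      ∀ w, h z + ⟪y, w - z⟫ ≤ h w := by
    intro z y hy hm w
    have := hle w y hy
    rw [heq z y hy hm, inner_sub_right]; linarith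
  have hcont : Continuous h := by
    have : LipschitzWith 1 h := by
      refine LipschitzWith.of_le_add fun z w => ?_
      have h1 := hsub z (Y z) (hYmem z) (hYmin z) w
      have h2 : |⟪Y z, w - z⟫| ≤ ‖Y z‖ * ‖w - z‖ := abs_real_inner_le_norm _ _
      have h3 : ‖Y z‖ ≤ 1 := by simpa using hYmem z
      have h4 : ‖Y z‖ * ‖w - z‖ ≤ 1 * ‖w - z‖ := by gcongr
      rw [dist_comm, dist_eq_norm]
      linarith [neg_abs_le ⟪Y z, w - z⟫]
    exact this.continuous
  set d := z₂ - z₁ with hd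
  rcases eq_or_ne d 0 with hd0 | hd0
  · have : z₁ - z₂ = 0 := by rw [← neg_sub, ← hd, hd0, neg_zero]
    rw [this, norm_zero]; positivity
  have hdpos : 0 < ‖d‖ := norm_pos_iff.2 hd0
  set C : ℝ := (2 * κ)⁻¹ * ‖d‖ ^ 2 with hC
  have hCpos : 0 < C := by positivity
  have key : C ≤ ⟪y₂ - y₁, d⟫ := by
    by_contra! hlt
    rw [inner_sub_left] at hlt
    obtain ⟨m, hm, hm'⟩ := exists_between (show ⟪y₂, d⟫ - C < ⟪y₁, d⟫ by linarith)
    obtain ⟨t₀, ht₀, hmax⟩ := exists_interior_tilted_max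
      (f := fun t => h (z₁ + t • d) - C * t ^ 2 / 2) (m₀ := ⟪y₁, d⟫) (m := m)
      (m₁ := ⟪y₂, d⟫ - C) (C := C / 2)
      (by
        have : Continuous fun t : ℝ => h (z₁ + t • d) - C * t ^ 2 / 2 := by fun_prop
        exact this.continuousOn)
      (by
        intro t _
        have := hsub z₁ y₁ hy₁ hm₁ (z₁ + t • d)
        simp only [add_sub_cancel_left, inner_smul_right] at this
        simp only [zero_smul, add_zero]
        nlinarith)
      (by
        intro t _
        have := hsub z₂ y₂ hy₂ hm₂ (z₁ + t • d)
        have e : z₁ + t • d - z₂ = (t - 1) • d := by rw [hd]; module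
        have e' : z₁ + d = z₂ := by rw [hd]; abel
        rw [e, inner_smul_right] at this
        simp only [one_smul, e']
        nlinarith) hm' hm
    set z₀ := z₁ + t₀ • d with hz₀
    have hz₀B : z₀ ∈ B := by
      refine hB.segment_subset hz₁ hz₂ ?_
      rw [segment_eq_image']
      exact ⟨t₀, ⟨ht₀.1.le, ht₀.2.le⟩, rfl⟩
    have hup : ∀ᶠ τ : ℝ in 𝓝 0,
        h (z₀ + τ • d) ≤ h z₀ + (C * t₀ + m) * τ + C * τ ^ 2 / 2 := by
      have : Tendsto (fun τ : ℝ => t₀ + τ) (𝓝 0) (𝓝 t₀) := by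
        simpa using (continuous_const_add t₀).tendsto 0
      filter_upwards [this.eventually (Icc_mem_nhds ht₀.1 ht₀.2)] with τ hτ
      have := hmax _ hτ
      simp only [add_smul, ← add_assoc, ← hz₀] at this
      nlinarith
    have hlow : ∀ τ : ℝ, h z₀ + τ * ⟪Y z₀, d⟫ ≤ h (z₀ + τ • d) := fun τ => by
      simpa [inner_smul_right] using hsub z₀ (Y z₀) (hYmem _) (hYmin _) (z₀ + τ • d)
    have hslope : ⟪Y z₀, d⟫ = C * t₀ + m := by
      have hboth : ∀ᶠ τ : ℝ in 𝓝[>] 0, |⟪Y z₀, d⟫ - (C * t₀ + m)| ≤ C * τ / 2 := by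
        have hneg : Tendsto (fun τ : ℝ => -τ) (𝓝 0) (𝓝 0) := by
          simpa using continuous_neg.tendsto (0 : ℝ)
        filter_upwards [self_mem_nhdsWithin, nhdsWithin_le_nhds hup,
          nhdsWithin_le_nhds (hneg.eventually hup)] with τ hτ h1 h2
        have hτ' : 0 < τ := hτ
        have l1 := hlow τ
        have l2 := hlow (-τ)
        rw [abs_le]
        constructor <;> refine le_of_mul_le_mul_left ?_ hτ' <;> nlinarith
      have hlim : Tendsto (fun τ : ℝ => C * τ / 2) (𝓝[>] 0) (𝓝 0) := by
        have : Continuous fun τ : ℝ => C * τ / 2 := by fun_prop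
        simpa using (this.tendsto 0).mono_left nhdsWithin_le_nhds
      have := ge_of_tendsto hlim hboth
      have := abs_nonpos_iff.1 this
      linarith
    refine hS (Y z₀) (hint z₀ hz₀B _ (hYmem _) (hYmin _)) (z₀ - Y z₀) ((√C)⁻¹ • d) 1 zero_le_one
      ?_ ?_
    · rw [norm_smul, mul_pow, Real.norm_eq_abs, sq_abs, inv_pow, Real.sq_sqrt hCpos.le, hC]
      have : ((2 * κ)⁻¹ * ‖d‖ ^ 2)⁻¹ * ‖d‖ ^ 2 = 2 * κ := by field_simp
      rw [this]; linarith
    · have hτ : Tendsto (fun y => C⁻¹ * ⟪d, y - Y z₀⟫) (𝓝 (Y z₀)) (𝓝 0) := by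
        have : Continuous fun y => C⁻¹ * ⟪d, y - Y z₀⟫ := by fun_prop
        simpa using this.tendsto (Y z₀)
      filter_upwards [hτ.eventually hup,
        isOpen_ball.mem_nhds (hint z₀ hz₀B _ (hYmem _) (hYmin _))] with y hy hyB
      have h1 := hle (z₀ + (C⁻¹ * ⟪d, y - Y z₀⟫) • d) y (ball_subset_closedBall hyB)
      have h2 := heq z₀ (Y z₀) (hYmem _) (hYmin _)
      rw [← hslope] at hy
      have e1 : ⟪d, y - Y z₀⟫ = ⟪y, d⟫ - ⟪Y z₀, d⟫ := by
        rw [inner_sub_right, real_inner_comm, real_inner_comm d (Y z₀)]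
      have e2 : ‖y‖ ^ 2 = ‖Y z₀‖ ^ 2 + 2 * ⟪Y z₀, y - Y z₀⟫ + ‖y - Y z₀‖ ^ 2 := by
        rw [← norm_add_sq_real]; congr 2; abel
      have e3 : ⟪z₀ - Y z₀, y - Y z₀⟫ = ⟪y, z₀⟫ - ⟪Y z₀, z₀⟫ - ⟪Y z₀, y - Y z₀⟫ := by
        rw [inner_sub_left, inner_sub_right z₀, real_inner_comm, real_inner_comm z₀ (Y z₀)]
      rw [inner_add_right, inner_smul_right] at h1
      rw [real_inner_smul_left, mul_pow, inv_pow, Real.sq_sqrt hCpos.le, e3]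
      rw [e1] at h1 hy ⊢
      generalize ⟪y, d⟫ = a at *
      generalize ⟪Y z₀, d⟫ = b at *
      have e4 : C * (C⁻¹ * (a - b)) ^ 2 = C⁻¹ * (a - b) ^ 2 := by field_simp
      have e5 : C⁻¹ * (a - b) * a - b * (C⁻¹ * (a - b)) = C⁻¹ * (a - b) ^ 2 := by ring
      linarith
  have h5 : ⟪y₂ - y₁, d⟫ ≤ ‖y₂ - y₁‖ * ‖d‖ := real_inner_le_norm _ _
  have h6 : (2 * κ)⁻¹ * ‖d‖ ≤ ‖y₂ - y₁‖ := by
    refine le_of_mul_le_mul_right ?_ hdpos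
    calc (2 * κ)⁻¹ * ‖d‖ * ‖d‖ = C := by rw [hC]; ring
      _ ≤ _ := key.trans h5
  rw [norm_sub_rev z₁, norm_sub_rev y₁, ← hd]
  rwa [inv_mul_le_iff₀ (by positivity)] at h6

/-- A Lipschitz map increases Haar measure at most by the power of its Lipschitz constant. -/
theorem addHaar_image_le_of_lipschitzOnWith [FiniteDimensional ℝ E] [MeasurableSpace E]
    [BorelSpace E] (μ : Measure E) [μ.IsAddHaarMeasure] {f : E → E} {L : NNReal} {s : Set E}
    (hf : LipschitzOnWith L f s) : μ (f '' s) ≤ (L : ENNReal) ^ finrank ℝ E * μ s := by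
  have h := hf.hausdorffMeasure_image_le (d := finrank ℝ E) (Nat.cast_nonneg _)
  have hμ := Measure.isAddLeftInvariant_eq_smul μ (Measure.hausdorffMeasure (finrank ℝ E) : Measure E)
  rw [hμ, Measure.smul_apply, Measure.smul_apply, ENNReal.smul_def, ENNReal.smul_def, smul_eq_mul,
    smul_eq_mul, mul_left_comm]
  rw [ENNReal.rpow_natCast] at h
  gcongr

theorem Real.one_add_add_sq_div_four_le_exp {x : ℝ} (hx : |x| ≤ 1) :
    1 + x + x ^ 2 / 4 ≤ Real.exp x := by
  have h := Real.exp_bound hx (n := 3) (by norm_num)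
  simp only [Finset.sum_range_succ, Finset.sum_range_zero, Nat.factorial] at h
  norm_num at h
  have h3 : |x| ^ 3 ≤ x ^ 2 := by
    rw [← sq_abs x]
    nlinarith [abs_nonneg x, sq_nonneg |x|]
  have := neg_abs_le (Real.exp x - (1 + x + x ^ 2 / 2))
  nlinarith [sq_nonneg x]

/-- The Gaussian is a strict subsolution away from its centre, so it cannot touch a supersolution
from below there. -/
theorem NoConvexTouching.not_gaussian_le {κ : ℝ} {U : Set E} {v : E → ℝ}
    (hv : NoConvexTouching κ U v) {x₀ : E} (hx₀ : x₀ ∈ U) {m p : ℝ} (hm : 0 < m) (hp : 0 < p)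
    (hκp : 5 * κ < 4 * p * ‖x₀‖ ^ 2) :
    ¬ ∀ᶠ x in 𝓝 x₀,
      v x₀ + m * (Real.exp (-(p * ‖x‖ ^ 2)) - Real.exp (-(p * ‖x₀‖ ^ 2))) ≤ v x := by
  intro hev
  set e₀ := Real.exp (-(p * ‖x₀‖ ^ 2)) with he₀
  have he₀pos : 0 < e₀ := Real.exp_pos _
  have hc : 0 < m * e₀ := by positivity
  refine hv x₀ hx₀ (-(2 * p * (m * e₀)) • x₀) ((√(2 * (m * e₀)) * p) • x₀) (m * e₀ * (5 * p / 2))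
    (by positivity) ?_ ?_
  · rw [norm_smul, mul_pow, Real.norm_eq_abs, sq_abs, mul_pow, Real.sq_sqrt (by positivity)]
    have : 0 < m * e₀ * p := by positivity
    nlinarith
  · have ht : Tendsto (fun x : E => 2 * p * ⟪x₀, x - x₀⟫) (𝓝 x₀) (𝓝 0) := by
      have : Continuous (fun x : E => 2 * p * ⟪x₀, x - x₀⟫) := by fun_prop
      simpa using this.tendsto x₀
    have ht' : Tendsto (fun x : E => p * ‖x - x₀‖ ^ 2) (𝓝 x₀) (𝓝 0) := by
      have : Continuous (fun x : E => p * ‖x - x₀‖ ^ 2) := by fun_prop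
      simpa using this.tendsto x₀
    filter_upwards [hev, ht.eventually (Icc_mem_nhds (a := -(1 / 2)) (b := 1 / 2) (by norm_num)
      (by norm_num)), ht'.eventually (Iic_mem_nhds (show (0 : ℝ) < 1 / 2 by norm_num))] with x hx hA hB
    have e1 : ‖x‖ ^ 2 = ‖x₀‖ ^ 2 + 2 * ⟪x₀, x - x₀⟫ + ‖x - x₀‖ ^ 2 := by
      rw [← norm_add_sq_real]; congr 2; abel
    have e2 : Real.exp (-(p * ‖x‖ ^ 2)) =
        e₀ * Real.exp (-(2 * p * ⟪x₀, x - x₀⟫) - p * ‖x - x₀‖ ^ 2) := by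
      rw [he₀, ← Real.exp_add, e1]; congr 1; ring
    rw [e2] at hx
    simp only [real_inner_smul_left, mul_pow, Real.sq_sqrt (show 0 ≤ 2 * (m * e₀) by positivity)]
    refine le_trans ?_ hx
    have hB0 : 0 ≤ p * ‖x - x₀‖ ^ 2 := by positivity
    generalize ⟪x₀, x - x₀⟫ = a at *
    generalize hb : ‖x - x₀‖ ^ 2 = b at *
    have hexp := Real.one_add_add_sq_div_four_le_exp (x := -(2 * p * a) - p * b)
      (by rw [abs_le]; constructor <;> linarith [hA.1, hA.2, show p * b ≤ 1 / 2 from hB])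
    have h1 : -(2 * p * a) + p ^ 2 * a ^ 2 - 5 / 4 * (p * b) ≤
        Real.exp (-(2 * p * a) - p * b) - 1 := by
      nlinarith [hA.1, hA.2, mul_nonneg hB0 (sub_nonneg.2 hA.1), sq_nonneg (p * b)]
    have h2 := mul_le_mul_of_nonneg_left h1 hc.le
    linarith

/-- A small value of a nonnegative supersolution spreads to a small ball. -/
theorem exists_value_lt_near_center [FiniteDimensional ℝ E] (κ : ℝ) (hκ : 1 ≤ κ) :
    ∃ δ : ℝ, 0 < δ ∧ δ < 1 ∧ ∀ u : E → ℝ, ContinuousOn u (closedBall 0 4) →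
      NoConvexTouching κ (ball 0 4) u → (∀ x ∈ closedBall (0 : E) 4, 0 ≤ u x) →
      (∃ x ∈ closedBall (0 : E) 3, u x ≤ δ) → ∃ x ∈ closedBall (0 : E) (1 / 4), u x < 1 / 4 := by
  set p := 21 * κ with hp
  have hp0 : 0 < p := by positivity
  have hgap : Real.exp (-(p * 16)) < Real.exp (-(p * 9)) := Real.exp_lt_exp.2 (by linarith)
  have hone : Real.exp (-(p * 9)) < 1 := by
    rw [← Real.exp_zero]; exact Real.exp_lt_exp.2 (by linarith)
  refine ⟨1 / 8 * (Real.exp (-(p * 9)) - Real.exp (-(p * 16))), by linarith,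
    by linarith [Real.exp_pos (-(p * 16))], ?_⟩
  rintro u hu hS hpos ⟨x₁, hx₁, hux₁⟩
  by_contra! hbig
  obtain ⟨y, hy, hmin⟩ := (isCompact_closedBall (0 : E) 4).exists_isMinOn ⟨0, by simp⟩
    (hu.sub (by fun_prop : Continuous fun x : E => 1 / 4 * Real.exp (-(p * ‖x‖ ^ 2))).continuousOn)
  have hmin' : ∀ x ∈ closedBall (0 : E) 4, u y - 1 / 4 * Real.exp (-(p * ‖y‖ ^ 2)) ≤
      u x - 1 / 4 * Real.exp (-(p * ‖x‖ ^ 2)) := fun x hx => hmin hx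
  rw [mem_closedBall_zero_iff] at hx₁ hy
  have hx₁' : Real.exp (-(p * 9)) ≤ Real.exp (-(p * ‖x₁‖ ^ 2)) := by
    apply Real.exp_le_exp.2
    have : ‖x₁‖ ^ 2 ≤ 9 := by nlinarith [norm_nonneg x₁]
    nlinarith
  have hlt := hmin' x₁ (by rw [mem_closedBall_zero_iff]; linarith)
  have hy0 := hpos y (by rwa [mem_closedBall_zero_iff])
  have hy4 : ‖y‖ < 4 := by
    refine lt_of_le_of_ne hy fun h => ?_
    rw [h, show (4 : ℝ) ^ 2 = 16 by norm_num] at hlt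
    linarith
  have hy14 : 1 / 4 < ‖y‖ := by
    by_contra! h
    have h1 := hbig y (by rwa [mem_closedBall_zero_iff])
    have h2 : Real.exp (-(p * ‖y‖ ^ 2)) ≤ 1 := Real.exp_le_one_iff.2 (by
      have : 0 ≤ p * ‖y‖ ^ 2 := by positivity
      linarith)
    linarith [Real.exp_pos (-(p * 16))]
  have hyball : y ∈ ball (0 : E) 4 := by rwa [mem_ball_zero_iff]
  have hy16 : 1 / 16 < ‖y‖ ^ 2 := by nlinarith
  refine hS.not_gaussian_le hyball (m := 1 / 4) (by norm_num) hp0 (by rw [hp]; nlinarith) ?_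
  filter_upwards [isOpen_ball.mem_nhds hyball] with x hx
  linarith [hmin' x (ball_subset_closedBall hx)]

/-- The basic measure estimate: if a nonnegative supersolution is small somewhere, it is bounded
on a set of substantial measure. -/
theorem measure_sublevel_unit [FiniteDimensional ℝ E] [MeasurableSpace E] [BorelSpace E]
    (μ : Measure E) [μ.IsAddHaarMeasure] {κ : ℝ} (hκ : 1 ≤ κ) {u : E → ℝ}
    (hu : ContinuousOn u (closedBall 0 4)) (hS : NoConvexTouching κ (ball 0 4) u)
    (hpos : ∀ x ∈ closedBall (0 : E) 4, 0 ≤ u x)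
    (hsmall : ∃ x ∈ closedBall (0 : E) (1 / 4), u x < 1 / 4) :
    μ (ball 0 (1 / 8)) ≤
      (Real.toNNReal (2 * κ) : ENNReal) ^ finrank ℝ E * μ (ball 0 1 ∩ {x | u x ≤ 1}) := by
  obtain ⟨x₂, hx₂, hux₂⟩ := hsmall
  rw [mem_closedBall_zero_iff] at hx₂
  have hsub : closedBall (0 : E) 1 ⊆ closedBall 0 4 := closedBall_subset_closedBall (by norm_num)
  have hval : ∀ z ∈ ball (0 : E) (1 / 8), ∀ y ∈ closedBall (0 : E) 1,
      (∀ x ∈ closedBall (0 : E) 1, u y + ‖y - z‖ ^ 2 / 2 ≤ u x + ‖x - z‖ ^ 2 / 2) →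
      u y ≤ 1 ∧ y ∈ ball (0 : E) 1 := by
    intro z hz y hy hm
    rw [mem_ball_zero_iff] at hz
    have h1 := hm x₂ (by rw [mem_closedBall_zero_iff]; linarith)
    have h2 : ‖x₂ - z‖ ≤ 3 / 8 := (norm_sub_le _ _).trans (by linarith)
    have h3 : ‖x₂ - z‖ ^ 2 ≤ 9 / 64 := by nlinarith [norm_nonneg (x₂ - z)]
    have h4 := hpos y (hsub hy)
    refine ⟨by nlinarith [sq_nonneg ‖y - z‖], ?_⟩
    rw [mem_ball_zero_iff]
    by_contra! h5
    have h6 : 7 / 8 ≤ ‖y - z‖ := by linarith [norm_sub_norm_le y z]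
    nlinarith
  have hex : ∀ z : E, ∃ y ∈ closedBall (0 : E) 1,
      ∀ x ∈ closedBall (0 : E) 1, u y + ‖y - z‖ ^ 2 / 2 ≤ u x + ‖x - z‖ ^ 2 / 2 := fun z =>
    (isCompact_closedBall (0 : E) 1).exists_isMinOn ⟨0, by simp⟩
      ((hu.mono hsub).add (by fun_prop : Continuous fun y => ‖y - z‖ ^ 2 / 2).continuousOn)
  choose Y hYmem hYmin using hex
  have hlip : ∀ z₁ ∈ ball (0 : E) (1 / 8), ∀ z₂ ∈ ball (0 : E) (1 / 8),
      ‖z₁ - z₂‖ ≤ 2 * κ * ‖Y z₁ - Y z₂‖ := fun z₁ hz₁ z₂ hz₂ =>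
    dist_vertex_le_of_contact (by linarith) (hu.mono hsub)
      (hS.mono (ball_subset_ball (by norm_num))) (convex_ball _ _)
      (fun z hz y hy hm => (hval z hz y hy hm).2) hz₁ hz₂ (hYmem _) (hYmem _) (hYmin _) (hYmin _)
  have hinj : InjOn Y (ball (0 : E) (1 / 8)) := fun z₁ hz₁ z₂ hz₂ h => by
    have := hlip z₁ hz₁ z₂ hz₂
    rw [h, sub_self, norm_zero, mul_zero] at this
    exact sub_eq_zero.1 (norm_le_zero_iff.1 this)
  have hlip' : LipschitzOnWith (Real.toNNReal (2 * κ)) (Function.invFunOn Y (ball (0 : E) (1 / 8)))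
      (Y '' ball (0 : E) (1 / 8)) := by
    refine LipschitzOnWith.of_dist_le_mul ?_
    rintro _ ⟨z₁, hz₁, rfl⟩ _ ⟨z₂, hz₂, rfl⟩
    rw [hinj.leftInvOn_invFunOn hz₁, hinj.leftInvOn_invFunOn hz₂, dist_eq_norm, dist_eq_norm,
      Real.coe_toNNReal _ (by linarith)]
    exact hlip z₁ hz₁ z₂ hz₂
  have himage := addHaar_image_le_of_lipschitzOnWith μ hlip'
  rw [hinj.leftInvOn_invFunOn.image_image] at himage
  refine himage.trans ?_
  gcongr
  rintro _ ⟨z, hz, rfl⟩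
  exact ⟨(hval z hz _ (hYmem z) (hYmin z)).2, (hval z hz _ (hYmem z) (hYmin z)).1⟩

open scoped Pointwise in
theorem addHaar_image_add_smul [FiniteDimensional ℝ E] [MeasurableSpace E] [BorelSpace E]
    (μ : Measure E) [μ.IsAddHaarMeasure] (c : E) {ρ : ℝ} (hρ : 0 < ρ) (s : Set E) :
    μ ((fun y => c + ρ • y) '' s) = ENNReal.ofReal (ρ ^ finrank ℝ E) * μ s := by
  have : (fun y => c + ρ • y) '' s = c +ᵥ (ρ • s) := by
    rw [← image_smul, ← image_vadd, image_image]; rfl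
  rw [this, measure_vadd, Measure.addHaar_smul, abs_of_pos (by positivity)]

/-- The basic measure estimate in a ball of arbitrary radius. -/
theorem exists_measure_sublevel [FiniteDimensional ℝ E] [MeasurableSpace E] [BorelSpace E]
    (μ : Measure E) [μ.IsAddHaarMeasure] {κ : ℝ} (hκ : 1 ≤ κ) :
    ∃ δ K : ℝ, 0 < δ ∧ δ < 1 ∧ 2 ≤ K ∧ ∀ (c : E) (ρ t : ℝ) (u : E → ℝ), 0 < ρ → 0 < t →
      ContinuousOn u (closedBall c (4 * ρ)) → NoConvexTouching κ (ball c (4 * ρ)) u →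
      (∀ x ∈ closedBall c (4 * ρ), 0 ≤ u x) → (∃ x ∈ closedBall c (3 * ρ), u x ≤ δ * t) →
      μ (closedBall c (5 * ρ)) ≤ ENNReal.ofReal K * μ (ball c ρ ∩ {x | u x ≤ t}) := by
  obtain ⟨δ, hδ, hδ1, hcenter⟩ := exists_value_lt_near_center (E := E) κ hκ
  have hball : μ (ball (0 : E) (1 / 8)) ≠ 0 := (measure_ball_pos μ _ (by norm_num)).ne'
  set L : ENNReal := μ (closedBall 0 5) / μ (ball (0 : E) (1 / 8)) *
    (Real.toNNReal (2 * κ) : ENNReal) ^ finrank ℝ E with hL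
  have hLtop : L ≠ ⊤ := by
    refine ENNReal.mul_ne_top (ENNReal.div_ne_top measure_closedBall_lt_top.ne hball) ?_
    exact ENNReal.pow_ne_top ENNReal.coe_ne_top
  refine ⟨δ, max 2 L.toReal, hδ, hδ1, le_max_left _ _, ?_⟩
  rintro c ρ t u hρ ht hu hS hpos ⟨x₁, hx₁, hux₁⟩
  have hpre : ∀ R : ℝ, (fun y : E => c + ρ • y) ⁻¹' ball c (R * ρ) = ball 0 R := fun R => by
    ext y
    simp only [mem_preimage, mem_ball, dist_self_add_left, dist_zero_right, norm_smul,
      Real.norm_eq_abs, abs_of_pos hρ, mul_comm ρ]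
    exact mul_lt_mul_iff_left₀ hρ
  have hmaps : ∀ R : ℝ, MapsTo (fun y : E => c + ρ • y) (closedBall 0 R) (closedBall c (R * ρ)) := by
    intro R y hy
    simp only [mem_closedBall, dist_self_add_left, dist_zero_right, norm_smul,
      Real.norm_eq_abs, abs_of_pos hρ, mul_comm ρ] at *
    gcongr
  have himage : ∀ R : ℝ, (fun y : E => c + ρ • y) '' closedBall 0 R = closedBall c (R * ρ) := by
    intro R
    refine (hmaps R).image_subset.antisymm fun x hx => ⟨ρ⁻¹ • (x - c), ?_, ?_⟩
    · rw [mem_closedBall_iff_norm] at hx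
      rw [mem_closedBall_zero_iff, norm_smul, norm_inv, Real.norm_eq_abs, abs_of_pos hρ,
        inv_mul_le_iff₀ hρ, mul_comm]
      exact hx
    · simp [smul_smul, hρ.ne']
  set v : E → ℝ := fun y => t⁻¹ * u (c + ρ • y) + 0 with hv
  have hvcont : ContinuousOn v (closedBall 0 4) := by
    refine (continuousOn_const.mul (hu.comp ?_ (hmaps 4))).add continuousOn_const
    exact (by fun_prop : Continuous fun y : E => c + ρ • y).continuousOn
  have hvS : NoConvexTouching κ (ball 0 4) v := by
    rw [← hpre 4]
    exact hS.rescale c hρ (inv_pos.2 ht) 0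
  have hvpos : ∀ y ∈ closedBall (0 : E) 4, 0 ≤ v y := fun y hy => by
    have := hpos _ (hmaps 4 hy)
    simp only [hv]; positivity
  rw [← himage 3] at hx₁
  obtain ⟨y₁, hy₁, rfl⟩ := hx₁
  have hunit := measure_sublevel_unit μ hκ hvcont hvS hvpos (hcenter v hvcont hvS hvpos
    ⟨y₁, hy₁, by simpa only [hv, add_zero, inv_mul_le_iff₀ ht, mul_comm t] using hux₁⟩)
  have hsublevel : (fun y : E => c + ρ • y) '' (ball 0 1 ∩ {y | v y ≤ 1}) ⊆
      ball c ρ ∩ {x | u x ≤ t} := by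
    rintro _ ⟨y, ⟨hy, hvy⟩, rfl⟩
    refine ⟨?_, ?_⟩
    · rwa [← hpre 1, mem_preimage, one_mul] at hy
    · simpa only [hv, add_zero, inv_mul_le_iff₀ ht, mul_one, mem_ofPred_eq] using hvy
  have h5 : μ (closedBall (0 : E) 5) ≤ L * μ (ball 0 1 ∩ {y | v y ≤ 1}) := by
    calc μ (closedBall (0 : E) 5)
        = μ (closedBall (0 : E) 5) / μ (ball (0 : E) (1 / 8)) * μ (ball (0 : E) (1 / 8)) :=
          (ENNReal.div_mul_cancel hball measure_ball_lt_top.ne).symm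
      _ ≤ _ := by rw [hL, mul_assoc]; gcongr
  calc μ (closedBall c (5 * ρ))
      = ENNReal.ofReal (ρ ^ finrank ℝ E) * μ (closedBall 0 5) := by
        rw [← himage, addHaar_image_add_smul μ c hρ]
    _ ≤ ENNReal.ofReal (ρ ^ finrank ℝ E) * (L * μ (ball 0 1 ∩ {y | v y ≤ 1})) := by gcongr
    _ = L * μ ((fun y : E => c + ρ • y) '' (ball 0 1 ∩ {y | v y ≤ 1})) := by
        rw [addHaar_image_add_smul μ c hρ, mul_left_comm]
    _ ≤ ENNReal.ofReal (max 2 L.toReal) * μ (ball c ρ ∩ {x | u x ≤ t}) := by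
        gcongr
        exact ENNReal.le_ofReal_iff_toReal_le hLtop (by positivity) |>.2 (le_max_right _ _)

/-- Covering argument behind the decay of superlevel sets: if every ball that stays away from the
sublevel set `{u ≤ s}` but is comparable to its distance to it contains a substantial part of
`{u ≤ t}`, then so does `{s < u}`. -/
theorem measure_superlevel_le [FiniteDimensional ℝ E] [MeasurableSpace E] [BorelSpace E]
    (μ : Measure E) {K s t : ℝ} {u : E → ℝ}
    (hu : ContinuousOn u (closedBall 0 1)) (h0 : u 0 ≤ s)
    (hK : ∀ (c : E) (ρ : ℝ), 0 < ρ → ρ ≤ 1 / 2 → ball c ρ ⊆ ball 0 1 →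
      (∃ x ∈ closedBall c (3 * ρ), u x ≤ s) →
      μ (closedBall c (5 * ρ)) ≤ ENNReal.ofReal K * μ (ball c ρ ∩ {x | u x ≤ t})) :
    μ (ball 0 1 ∩ {x | s < u x}) ≤
      ENNReal.ofReal K * μ ((ball 0 1 ∩ {x | s < u x}) \ (ball 0 1 ∩ {x | t < u x})) := by
  have hopen : ∀ a : ℝ, IsOpen (ball (0 : E) 1 ∩ {x | a < u x}) := fun a =>
    (hu.mono ball_subset_closedBall).isOpen_inter_preimage isOpen_ball isOpen_Ioi
  set D : Set E := closedBall 0 1 ∩ {x | u x ≤ s} with hD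
  have hDclosed : IsClosed D := hu.preimage_isClosed_of_isClosed isClosed_closedBall isClosed_Iic
  have h0D : (0 : E) ∈ D := ⟨by simp, h0⟩
  set S := ball (0 : E) 1 ∩ {x | s < u x} with hSdef
  set ρ : E → ℝ := fun x => infDist x D / 2 with hρ
  set c : E → E := fun x => (1 - ρ x) • x with hc
  have hρpos : ∀ x ∈ S, 0 < ρ x := fun x hx => by
    have : x ∉ D := fun h => (not_le.2 hx.2 : ¬ u x ≤ s) h.2
    have := (hDclosed.notMem_iff_infDist_pos ⟨0, h0D⟩).1 this
    simp only [hρ]; linarith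
  have hnorm : ∀ x ∈ S, ‖x‖ < 1 := fun x hx => mem_ball_zero_iff.1 hx.1
  have hρle : ∀ x ∈ S, ρ x ≤ 1 / 2 := fun x hx => by
    have := infDist_le_dist_of_mem (x := x) h0D
    rw [dist_zero_right] at this
    simp only [hρ]; linarith [hnorm x hx]
  have hcx : ∀ x ∈ S, dist x (c x) ≤ ρ x := fun x hx => by
    have e : x - c x = ρ x • x := by simp only [hc, sub_smul, one_smul, sub_sub_cancel]
    rw [dist_eq_norm, e, norm_smul, Real.norm_eq_abs, abs_of_pos (hρpos x hx)]
    nlinarith [hρpos x hx, hnorm x hx]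
  have hball1 : ∀ x ∈ S, ball (c x) (ρ x) ⊆ ball 0 1 := fun x hx => by
    refine ball_subset_ball' ?_
    rw [dist_zero_right, norm_smul, Real.norm_eq_abs, abs_of_pos (by linarith [hρle x hx])]
    nlinarith [hρle x hx, hnorm x hx, norm_nonneg x]
  have hballS : ∀ x ∈ S, ball (c x) (ρ x) ⊆ S := fun x hx y hy => by
    refine ⟨hball1 x hx hy, ?_⟩
    by_contra! h
    have hyD : y ∈ D := ⟨ball_subset_closedBall (hball1 x hx hy), (not_lt.1 h : u y ≤ s)⟩
    have h1 := infDist_le_dist_of_mem (x := x) hyD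
    have h2 := dist_triangle x (c x) y
    rw [mem_ball, dist_comm] at hy
    have h3 := hcx x hx
    simp only [hρ] at *
    linarith
  have hest : ∀ x ∈ S, μ (closedBall (c x) (5 * ρ x)) ≤
      ENNReal.ofReal K * μ (ball (c x) (ρ x) ∩ {x | u x ≤ t}) := fun x hx => by
    refine hK _ _ (hρpos x hx) (hρle x hx) (hball1 x hx) ?_
    obtain ⟨y, hy, hxy⟩ := hDclosed.exists_infDist_eq_dist ⟨0, h0D⟩ x
    refine ⟨y, ?_, hy.2⟩
    have h2 := dist_triangle y x (c x)
    have h3 := hcx x hx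
    rw [mem_closedBall]
    rw [dist_comm] at hxy
    simp only [hρ] at *
    linarith
  obtain ⟨V, hVS, hVdisj, hVcov⟩ := Vitali.exists_disjoint_subfamily_covering_enlargement_closedBall
    S c ρ (1 / 2) hρle 5 (by norm_num)
  have hVdisj' : V.PairwiseDisjoint fun x => ball (c x) (ρ x) :=
    hVdisj.mono_on fun x _ => ball_subset_closedBall
  have hVcount : V.Countable := hVdisj'.countable_of_isOpen (fun _ _ => isOpen_ball)
    fun x hx => nonempty_ball.2 (hρpos x (hVS hx))
  have hset : ∀ x ∈ S, ball (c x) (ρ x) ∩ {x | u x ≤ t} =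
      ball (c x) (ρ x) \ (ball 0 1 ∩ {x | t < u x}) := fun x hx => by
    ext y
    simp only [mem_inter_iff, mem_ofPred_eq, Set.mem_sdiff, not_and, not_lt]
    exact ⟨fun h => ⟨h.1, fun _ => h.2⟩, fun h => ⟨h.1, h.2 (hball1 x hx h.1)⟩⟩
  calc μ S ≤ μ (⋃ x ∈ V, closedBall (c x) (5 * ρ x)) := by
        refine measure_mono fun x hx => ?_
        obtain ⟨b, hb, hsub⟩ := hVcov x hx
        exact mem_biUnion hb (hsub (hcx x hx))
    _ ≤ ∑' x : V, μ (closedBall (c x) (5 * ρ x)) := measure_biUnion_le _ hVcount _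
    _ ≤ ∑' x : V, ENNReal.ofReal K * μ (ball (c x) (ρ x) ∩ {x | u x ≤ t}) :=
        ENNReal.tsum_le_tsum fun x => hest x (hVS x.2)
    _ = ENNReal.ofReal K * μ (⋃ x ∈ V, ball (c x) (ρ x) ∩ {x | u x ≤ t}) := by
        rw [ENNReal.tsum_mul_left, measure_biUnion hVcount
          (hVdisj'.mono_on fun x _ => inter_subset_left)]
        intro x hx
        rw [hset x (hVS hx)]
        exact measurableSet_ball.diff (hopen t).measurableSet
    _ ≤ _ := by
        gcongr
        refine iUnion₂_subset fun x hx => ?_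
        rw [hset x (hVS hx)]
        exact sdiff_subset_sdiff_left (hballS x (hVS hx))

/-- Power decay of the superlevel sets of a nonnegative supersolution. -/
theorem exists_superlevel_decay [FiniteDimensional ℝ E] [MeasurableSpace E] [BorelSpace E]
    (μ : Measure E) [μ.IsAddHaarMeasure] {κ : ℝ} (hκ : 1 ≤ κ) :
    ∃ ε C : ℝ, 0 < ε ∧ 0 < C ∧ ∀ u : E → ℝ, ContinuousOn u (closedBall 0 3) →
      NoConvexTouching κ (ball 0 3) u → (∀ x ∈ closedBall (0 : E) 3, 0 ≤ u x) → u 0 ≤ 1 →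
      ∀ s : ℝ, 1 ≤ s → μ.real (ball 0 1 ∩ {x | s < u x}) ≤ C * s ^ (-ε) := by
  obtain ⟨δ, K, hδ, hδ1, hK2, hest⟩ := exists_measure_sublevel μ hκ
  set M := δ⁻¹ with hM
  have hM1 : 1 < M := (one_lt_inv₀ hδ).2 hδ1
  have hM0 : 0 < M := by positivity
  set θ := 1 - K⁻¹ with hθ
  have hKinv : K⁻¹ ≤ 1 / 2 := by
    rw [one_div]; exact inv_anti₀ (by norm_num) hK2
  have hKinv0 : 0 < K⁻¹ := by positivity
  have hθ0 : 0 < θ := by linarith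
  have hθ1 : θ < 1 := by linarith
  have hlogM : 0 < Real.log M := Real.log_pos hM1
  have hlogθ : Real.log θ < 0 := Real.log_neg hθ0 hθ1
  set ε := -Real.log θ / Real.log M with hε
  have hMε : M ^ (-ε) = θ := by
    rw [Real.rpow_def_of_pos hM0, hε]
    have : Real.log M * -(-Real.log θ / Real.log M) = Real.log θ := by field_simp
    rw [this, Real.exp_log hθ0]
  have hε0 : 0 < ε := div_pos (by linarith) hlogM
  refine ⟨ε, θ⁻¹ * (μ.real (ball (0 : E) 1) + 1), hε0, by positivity, ?_⟩
  intro u hu hS hpos h0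
  have hdecay : ∀ k : ℕ, μ.real (ball 0 1 ∩ {x | M ^ k < u x}) ≤
      θ ^ k * μ.real (ball (0 : E) 1) := by
    intro k
    induction k with
    | zero =>
      rw [pow_zero, pow_zero, one_mul]
      exact measureReal_mono inter_subset_left measure_ball_lt_top.ne
    | succ k ih =>
      have hMk : 1 ≤ M ^ k := one_le_pow₀ hM1.le
      have hstep := measure_superlevel_le μ (K := K) (s := M ^ k) (t := M ^ (k + 1))
        (hu.mono (closedBall_subset_closedBall (by norm_num))) (h0.trans hMk) (by
          intro c ρ hρ hρ2 hc hx
          have hcn : ‖c‖ ≤ 1 := by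
            have := closure_mono hc
            rw [closure_ball _ hρ.ne', closure_ball _ one_ne_zero] at this
            exact mem_closedBall_zero_iff.1 (this (mem_closedBall_self hρ.le))
          have hsub : closedBall c (4 * ρ) ⊆ closedBall 0 3 :=
            closedBall_subset_closedBall' (by rw [dist_zero_right]; linarith)
          have hsub' : ball c (4 * ρ) ⊆ ball 0 3 :=
            ball_subset_ball' (by rw [dist_zero_right]; linarith)
          refine hest c ρ (M ^ (k + 1)) u hρ (by positivity) (hu.mono hsub) (hS.mono hsub')
            (fun x hx => hpos x (hsub hx)) ?_
          have e : δ * M ^ (k + 1) = M ^ k := by rw [pow_succ, hM]; field_simp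
          rwa [e])
      have hsubset : ball (0 : E) 1 ∩ {x | M ^ (k + 1) < u x} ⊆ ball 0 1 ∩ {x | M ^ k < u x} := by
        refine inter_subset_inter_right _ fun x (hx : M ^ (k + 1) < u x) => ?_
        exact lt_of_le_of_lt (pow_le_pow_right₀ hM1.le (Nat.le_succ k)) hx
      have hmeas : MeasurableSet (ball (0 : E) 1 ∩ {x | M ^ (k + 1) < u x}) :=
        ((hu.mono (ball_subset_closedBall.trans (closedBall_subset_closedBall
          (by norm_num)))).isOpen_inter_preimage isOpen_ball isOpen_Ioi).measurableSet
      have hfin : ∀ s : Set E, μ (ball 0 1 ∩ s) ≠ ⊤ := fun s =>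
        measure_ne_top_of_subset inter_subset_left measure_ball_lt_top.ne
      have hreal := ENNReal.toReal_mono (ENNReal.mul_ne_top ENNReal.ofReal_ne_top
        (measure_ne_top_of_subset sdiff_subset (hfin _))) hstep
      rw [ENNReal.toReal_mul, ENNReal.toReal_ofReal (by linarith)] at hreal
      change μ.real _ ≤ K * μ.real _ at hreal
      rw [measureReal_sdiff hsubset hmeas (hfin _), ← inv_mul_le_iff₀ (by linarith)] at hreal
      calc μ.real (ball 0 1 ∩ {x | M ^ (k + 1) < u x})
          ≤ θ * μ.real (ball 0 1 ∩ {x | M ^ k < u x}) := by rw [hθ]; linarith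
        _ ≤ θ * (θ ^ k * μ.real (ball (0 : E) 1)) := by gcongr
        _ = _ := by ring
  intro s hs
  obtain ⟨k, hk, hk'⟩ := exists_nat_pow_near hs hM1
  calc μ.real (ball 0 1 ∩ {x | s < u x}) ≤ μ.real (ball 0 1 ∩ {x | M ^ k < u x}) := by
        refine measureReal_mono (inter_subset_inter_right _ fun x (hx : s < u x) => ?_)
          (measure_ne_top_of_subset inter_subset_left measure_ball_lt_top.ne)
        exact lt_of_le_of_lt hk hx
    _ ≤ θ ^ k * μ.real (ball (0 : E) 1) := hdecay k
    _ = θ⁻¹ * μ.real (ball (0 : E) 1) * θ ^ (k + 1) := by rw [pow_succ]; field_simp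
    _ ≤ θ⁻¹ * (μ.real (ball (0 : E) 1) + 1) * s ^ (-ε) := by
        have e : θ ^ (k + 1) = (M ^ (k + 1)) ^ (-ε) := by
          rw [← hMε, ← Real.rpow_natCast, ← Real.rpow_natCast, ← Real.rpow_mul hM0.le,
            ← Real.rpow_mul hM0.le, mul_comm]
        have h1 : θ ^ (k + 1) ≤ s ^ (-ε) := by
          rw [e]
          exact Real.rpow_le_rpow_of_nonpos (by linarith) hk'.le (by linarith)
        gcongr
        linarith

set_option maxHeartbeats 1000000 in
/-- Harnack inequality in the unit ball: a nonnegative supersolution which is also a subsolution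
where it is larger than its value at the centre is bounded by a multiple of that value. -/
theorem exists_harnack_unit [FiniteDimensional ℝ E] {κ : ℝ} (hκ : 1 ≤ κ) :
    ∃ C : ℝ, 1 ≤ C ∧ ∀ u : E → ℝ, ContinuousOn u (closedBall 0 3) →
      NoConvexTouching κ (ball 0 3) u → (∀ x ∈ closedBall (0 : E) 3, 0 ≤ u x) → u 0 ≤ 1 →
      NoConvexTouching κ (ball 0 3 ∩ {x | 1 < u x}) (fun x => -u x) →
      ∀ x ∈ closedBall (0 : E) (1 / 2), u x ≤ C := by
  let _ : MeasurableSpace E := borel E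
  have : BorelSpace E := ⟨rfl⟩
  set μ : Measure E := volume
  obtain ⟨δ, K, hδ, hδ1, hK2, hest⟩ := exists_measure_sublevel μ hκ
  obtain ⟨ε, C₁, hε, hC₁, hdecay⟩ := exists_superlevel_decay μ hκ
  set n := finrank ℝ E
  set q : ℕ := ⌈n / ε⌉₊ + 1 with hq
  have hqε : (n : ℝ) ≤ q * ε := by
    have h1 : (n : ℝ) / ε ≤ q := (Nat.le_ceil _).trans (by rw [hq]; push_cast; linarith)
    rwa [div_le_iff₀ hε] at h1
  have hq0 : 0 < (q : ℝ) := by rw [hq]; positivity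
  set η := δ / 2 with hη
  have hη0 : 0 < η := by positivity
  set τ := η / (q * (1 + η)) with hτ
  have hτ0 : 0 < τ := by positivity
  have hτq : q * τ = η / (1 + η) := by rw [hτ]; field_simp
  have hτ1 : τ < 1 := by
    have h1 : η / (1 + η) < 1 := (div_lt_one (by positivity)).2 (by linarith)
    have h2 : (1 : ℝ) ≤ q := by rw [hq]; push_cast; linarith [Nat.cast_nonneg (α := ℝ) ⌈n / ε⌉₊]
    nlinarith
  have hbern : 1 ≤ (1 + η) * (1 - τ) ^ q := by
    have h1 := one_add_mul_le_pow (show (-2 : ℝ) ≤ -τ by linarith) q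
    have h2 : 1 + (q : ℝ) * -τ = (1 + η)⁻¹ := by rw [mul_neg, hτq]; field_simp; ring
    rw [h2, ← sub_eq_add_neg] at h1
    calc 1 = (1 + η) * (1 + η)⁻¹ := by field_simp
      _ ≤ _ := by gcongr
  set c₀ := (5 * τ / 4) ^ n * μ.real (closedBall (0 : E) 1) with hc₀
  have hc₀pos : 0 < c₀ := by
    have : 0 < μ.real (closedBall (0 : E) 1) :=
      ENNReal.toReal_pos (measure_closedBall_pos μ _ one_pos).ne' measure_closedBall_lt_top.ne
    positivity
  set A := (K * C₁ * (2 : ℝ) ^ ε / c₀) with hA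
  have hA0 : 0 < A := by positivity
  refine ⟨2 ^ q * max 2 (A ^ ε⁻¹), ?_, ?_⟩
  · have h1 : (1 : ℝ) ≤ 2 ^ q := one_le_pow₀ (by norm_num)
    have h2 : (2 : ℝ) ≤ max 2 (A ^ ε⁻¹) := le_max_left _ _
    nlinarith
  intro u hu hS hpos h0 hsub
  have hsub13 : closedBall (0 : E) 1 ⊆ closedBall 0 3 := closedBall_subset_closedBall (by norm_num)
  obtain ⟨x₀, hx₀, hmax⟩ := (isCompact_closedBall (0 : E) 1).exists_isMaxOn ⟨0, by simp⟩
    ((hu.mono hsub13).mul (by fun_prop : Continuous fun x : E => (1 - ‖x‖) ^ q).continuousOn)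
  have hmax' : ∀ x ∈ closedBall (0 : E) 1, u x * (1 - ‖x‖) ^ q ≤ u x₀ * (1 - ‖x₀‖) ^ q :=
    fun x hx => hmax hx
  set Φ := u x₀ * (1 - ‖x₀‖) ^ q with hΦ
  suffices hbound : Φ ≤ max 2 (A ^ ε⁻¹) by
    intro x hx
    rw [mem_closedBall_zero_iff] at hx
    have hx1 : x ∈ closedBall (0 : E) 1 := by rw [mem_closedBall_zero_iff]; linarith
    have h1 : (1 / 2 : ℝ) ^ q ≤ (1 - ‖x‖) ^ q := by gcongr; linarith
    have h2 : u x * (1 / 2) ^ q ≤ max 2 (A ^ ε⁻¹) :=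
      (mul_le_mul_of_nonneg_left h1 (hpos x (hsub13 hx1))).trans ((hmax' x hx1).trans hbound)
    calc u x = 2 ^ q * (u x * (1 / 2) ^ q) := by
          rw [mul_left_comm, ← mul_pow]; norm_num
      _ ≤ _ := by gcongr
  by_contra! hbig
  obtain ⟨hΦ2, hΦA⟩ := max_lt_iff.1 hbig
  set d := 1 - ‖x₀‖ with hd
  have hd0 : 0 ≤ d := by rw [mem_closedBall_zero_iff] at hx₀; linarith
  have hdpos : 0 < d := by
    refine lt_of_le_of_ne hd0 fun h => ?_
    rw [hΦ, ← h, zero_pow (by omega), mul_zero] at hΦ2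
    linarith
  have hd1 : d ≤ 1 := by linarith [norm_nonneg x₀]
  set s := u x₀ with hs
  have hdq : 0 < d ^ q := by positivity
  have hs2 : 2 < s := by
    have : d ^ q ≤ 1 := pow_le_one₀ hd0 hd1
    have : 0 ≤ s := hpos _ (hsub13 hx₀)
    nlinarith
  -- near the maximum point `u` is at most `(1 + η) s`
  have hτd : τ * d ≤ d := by nlinarith
  have hsubd : closedBall x₀ (τ * d) ⊆ closedBall 0 1 :=
    closedBall_subset_closedBall' (by rw [dist_zero_right]; linarith)
  have hnear : ∀ x ∈ closedBall x₀ (τ * d), u x ≤ (1 + η) * s := by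
    intro x hx
    have h1 := hmax' x (hsubd hx)
    have h2 : (1 - τ) * d ≤ 1 - ‖x‖ := by
      rw [mem_closedBall_iff_norm] at hx
      linarith [norm_sub_norm_le x x₀]
    have h3 : ((1 - τ) * d) ^ q ≤ (1 - ‖x‖) ^ q :=
      pow_le_pow_left₀ (mul_nonneg (by linarith) hd0) h2 q
    have h4 : 0 ≤ u x := hpos x (hsub13 (hsubd hx))
    rw [mul_pow] at h3
    have h5 : u x * (1 - τ) ^ q ≤ s := by
      refine le_of_mul_le_mul_right ?_ hdq
      calc u x * (1 - τ) ^ q * d ^ q = u x * ((1 - τ) ^ q * d ^ q) := by ring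
        _ ≤ u x * (1 - ‖x‖) ^ q := by gcongr
        _ ≤ s * d ^ q := h1
    calc u x ≤ u x * ((1 + η) * (1 - τ) ^ q) := le_mul_of_one_le_right h4 hbern
      _ = (1 + η) * (u x * (1 - τ) ^ q) := by ring
      _ ≤ _ := by gcongr
  set ρ := τ * d / 4 with hρ
  have h4ρ : 4 * ρ = τ * d := by rw [hρ]; ring
  have hρ0 : 0 < ρ := by positivity
  set Z : E → ℝ := fun x => min (-u x) (-1) + (1 + η) * s with hZ
  have hball3 : ball x₀ (4 * ρ) ⊆ ball 0 3 := by
    rw [h4ρ]; exact ball_subset_ball' (by rw [dist_zero_right]; linarith)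
  have hZS : NoConvexTouching κ (ball x₀ (4 * ρ)) Z := by
    have h1 : NoConvexTouching κ (ball 0 3) (fun x => min (-u x) (-1)) := by
      refine NoConvexTouching.min_const hκ (hsub.mono ?_)
      exact inter_subset_inter_right _ fun x (hx : -u x < -1) => (by linarith : 1 < u x)
    have h2 := h1.rescale 0 one_pos one_pos ((1 + η) * s)
    simp only [one_smul, zero_add, one_mul, preimage_id'] at h2
    exact h2.mono hball3
  have hZcont : ContinuousOn Z (closedBall x₀ (4 * ρ)) := by
    rw [h4ρ]
    have h1 : ContinuousOn (fun x => -u x) (closedBall x₀ (τ * d)) :=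
      (hu.mono (hsubd.trans hsub13)).neg
    exact (h1.inf continuousOn_const).add continuousOn_const
  have hZpos : ∀ x ∈ closedBall x₀ (4 * ρ), 0 ≤ Z x := by
    intro x hx
    rw [h4ρ] at hx
    have h1 := hnear x hx
    have h2 : -((1 + η) * s) ≤ min (-u x) (-1) := le_min (by linarith) (by nlinarith)
    simp only [hZ]; linarith
  have hZx₀ : Z x₀ ≤ δ * (s / 2) := by
    have h1 : min (-u x₀) (-1) ≤ -s := min_le_left _ _
    have h2 : δ * (s / 2) = η * s := by rw [hη]; ring
    simp only [hZ]
    linarith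
  have hlow := hest x₀ ρ (s / 2) Z hρ0 (by linarith) hZcont hZS hZpos
    ⟨x₀, mem_closedBall_self (by positivity), hZx₀⟩
  have hsubset : ball x₀ ρ ∩ {x | Z x ≤ s / 2} ⊆ ball 0 1 ∩ {x | s / 2 < u x} := by
    rintro x ⟨hx, hZx⟩
    refine ⟨?_, ?_⟩
    · refine ball_subset_ball' (ε₁ := ρ) ?_ hx
      rw [dist_zero_right]; linarith
    · have h1 : min (-u x) (-1) + (1 + η) * s ≤ s / 2 := hZx
      change s / 2 < u x
      by_contra! h2
      have h3 : -(s / 2) ≤ min (-u x) (-1) := le_min (by linarith) (by linarith)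
      have h4 : 0 < η * s := mul_pos hη0 (by linarith)
      linarith
  have hfin : μ (ball 0 1 ∩ {x | s / 2 < u x}) ≠ ⊤ :=
    measure_ne_top_of_subset inter_subset_left measure_ball_lt_top.ne
  have hreal : c₀ * d ^ n ≤ K * μ.real (ball 0 1 ∩ {x | s / 2 < u x}) := by
    have h1 := ENNReal.toReal_mono (ENNReal.mul_ne_top ENNReal.ofReal_ne_top hfin)
      (hlow.trans (mul_le_mul_right (measure_mono hsubset) _))
    rw [ENNReal.toReal_mul, ENNReal.toReal_ofReal (by linarith),
      Measure.addHaar_closedBall' μ _ (by positivity), ENNReal.toReal_mul,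
      ENNReal.toReal_ofReal (by positivity)] at h1
    refine le_trans (le_of_eq ?_) h1
    rw [hc₀, hρ, mul_right_comm, ← mul_pow]
    congr 2
    ring
  have hupper := hdecay u hu hS hpos h0 (s / 2) (by linarith)
  have hfinal : Φ ^ ε ≤ A := by
    have hs0 : 0 < s := by linarith
    have e1 : Φ ^ ε = s ^ ε * d ^ (q * ε) := by
      rw [hΦ, Real.mul_rpow hs0.le hdq.le, ← Real.rpow_natCast d q, ← Real.rpow_mul hd0]
    have e2 : d ^ (q * ε) ≤ d ^ n := by
      rw [← Real.rpow_natCast d n]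
      exact Real.rpow_le_rpow_of_exponent_ge hdpos hd1 hqε
    have e3 : (s / 2) ^ (-ε) = 2 ^ ε / s ^ ε := by
      rw [Real.rpow_neg (by positivity), Real.div_rpow hs0.le (by norm_num), inv_div]
    have hsε : 0 < s ^ ε := by positivity
    rw [e3] at hupper
    have h1 : c₀ * d ^ n ≤ K * (C₁ * (2 ^ ε / s ^ ε)) := hreal.trans (by gcongr)
    rw [e1, hA, le_div_iff₀ hc₀pos]
    calc s ^ ε * d ^ (q * ε) * c₀ ≤ s ^ ε * (c₀ * d ^ n) := by
          rw [mul_assoc, mul_comm c₀]; gcongr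
      _ ≤ s ^ ε * (K * (C₁ * (2 ^ ε / s ^ ε))) := by gcongr
      _ = K * C₁ * 2 ^ ε := by field_simp
  have hΦle : Φ ≤ A ^ ε⁻¹ := by
    rw [Real.le_rpow_inv_iff_of_pos (by linarith) hA0.le hε]
    exact hfinal
  linarith

/-- Local form of the Harnack inequality on a ball of radius `ρ / 2`. -/
theorem harnack_step {κ C : ℝ}
    (hC : ∀ u : E → ℝ, ContinuousOn u (closedBall 0 3) →
      NoConvexTouching κ (ball 0 3) u → (∀ x ∈ closedBall (0 : E) 3, 0 ≤ u x) → u 0 ≤ 1 →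
      NoConvexTouching κ (ball 0 3 ∩ {x | 1 < u x}) (fun x => -u x) →
      ∀ x ∈ closedBall (0 : E) (1 / 2), u x ≤ C)
    {R ρ t : ℝ} {u : E → ℝ} (hu : ContinuousOn u (ball 0 R))
    (hS : NoConvexTouching κ (ball 0 R) u) (hpos : ∀ x ∈ ball (0 : E) R, 0 ≤ u x)
    (hsub : NoConvexTouching κ (ball 0 R ∩ {x | 2 < u x}) (fun x => -u x))
    (hρ : 0 < ρ) (ht : 2 ≤ t) {x y : E} (hx : ‖x‖ + 3 * ρ < R) (hux : u x ≤ t)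
    (hxy : ‖y - x‖ ≤ ρ / 2) : u y ≤ C * t := by
  have ht0 : 0 < t := by linarith
  have hmem : ∀ z ∈ closedBall (0 : E) 3, x + ρ • z ∈ ball (0 : E) R := fun z hz => by
    rw [mem_closedBall_zero_iff] at hz
    rw [mem_ball_zero_iff]
    have h1 := norm_add_le x (ρ • z)
    rw [norm_smul, Real.norm_eq_abs, abs_of_pos hρ] at h1
    nlinarith
  have hmem' : ∀ z ∈ ball (0 : E) 3, x + ρ • z ∈ ball (0 : E) R :=
    fun z hz => hmem z (ball_subset_closedBall hz)
  have key := hC (fun z => t⁻¹ * u (x + ρ • z) + 0) ?_ ?_ ?_ ?_ ?_ (ρ⁻¹ • (y - x)) ?_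
  · simp only [smul_smul, mul_inv_cancel₀ hρ.ne', one_smul, add_sub_cancel, add_zero] at key
    rwa [inv_mul_le_iff₀ ht0, mul_comm] at key
  · have h1 : ContinuousOn (fun z => u (x + ρ • z)) (closedBall 0 3) :=
      hu.comp (by fun_prop) hmem
    exact (h1.const_mul _ |>.add continuousOn_const)
  · exact (hS.rescale x hρ (inv_pos.2 ht0) 0).mono hmem'
  · intro z hz
    have := hpos _ (hmem z hz)
    positivity
  · simp only [smul_zero, add_zero]
    rwa [inv_mul_le_iff₀ ht0, mul_one]
  · have h1 := (hsub.rescale x hρ (inv_pos.2 ht0) 0).mono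
      (U := ball 0 3 ∩ {z | 1 < t⁻¹ * u (x + ρ • z) + 0}) ?_
    · convert h1 using 2
      ring
    · rintro z ⟨hz, hz1 : 1 < t⁻¹ * u (x + ρ • z) + 0⟩
      refine ⟨hmem' z hz, (?_ : 2 < u (x + ρ • z))⟩
      rw [add_zero, lt_inv_mul_iff₀ ht0] at hz1
      linarith
  · rw [mem_closedBall_zero_iff, norm_smul, norm_inv, Real.norm_eq_abs, abs_of_pos hρ,
      inv_mul_le_iff₀ hρ]
    linarith

/-- Harnack inequality on a quarter of the ball, obtained by chaining. -/
theorem exists_harnack_quarter [FiniteDimensional ℝ E] {κ : ℝ} (hκ : 1 ≤ κ) :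
    ∃ C : ℝ, 0 < C ∧ ∀ (R : ℝ) (u : E → ℝ), 0 < R → ContinuousOn u (ball 0 R) →
      NoConvexTouching κ (ball 0 R) u → (∀ x ∈ ball (0 : E) R, 0 ≤ u x) → u 0 ≤ 1 →
      NoConvexTouching κ (ball 0 R ∩ {x | 2 < u x}) (fun x => -u x) →
      ∀ x ∈ ball (0 : E) (R / 4), u x ≤ C := by
  obtain ⟨C, hC1, hC⟩ := exists_harnack_unit (E := E) hκ
  refine ⟨C * (C * (C * 2)), by positivity, fun R u hR hu hS hpos h0 hsub x hx => ?_⟩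
  rw [mem_ball_zero_iff] at hx
  have step : ∀ a b t : ℝ, 0 ≤ a → a ≤ 1 → |b - a| ≤ 1 / 3 → 2 ≤ t → u (a • x) ≤ t →
      u (b • x) ≤ C * t := by
    intro a b t ha ha1 hab ht hut
    refine harnack_step hC hu hS hpos hsub (show 0 < R / 5 by positivity) ht (x := a • x) ?_ hut ?_
    · rw [norm_smul, Real.norm_eq_abs, abs_of_nonneg ha]
      have : a * ‖x‖ ≤ ‖x‖ := mul_le_of_le_one_left (norm_nonneg x) ha1
      linarith
    · rw [← sub_smul, norm_smul, Real.norm_eq_abs]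
      have : |b - a| * ‖x‖ ≤ 1 / 3 * ‖x‖ := by gcongr
      linarith
  have h1 := step 0 (1 / 3) 2 le_rfl (by norm_num) (by norm_num) le_rfl
    (by rw [zero_smul]; linarith)
  have h2 := step (1 / 3) (2 / 3) _ (by norm_num) (by norm_num) (by norm_num) (by nlinarith) h1
  have h3 := step (2 / 3) 1 _ (by norm_num) (by norm_num) (by norm_num) (by nlinarith) h2
  rwa [one_smul] at h3

end Harnack

section Viscosity

/-- A quadratic polynomial with Hessian `s q ⊗ q - b I`. -/
def testQuadratic {n : ℕ} (x₀ p q : Euc n) (c s b : ℝ) (x : Euc n) : ℝ :=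
  c + ⟪p, x - x₀⟫ + (s * ⟪q, x - x₀⟫ ^ 2 - b * ‖x - x₀‖ ^ 2) / 2

theorem contDiff_testQuadratic {n : ℕ} (x₀ p q : Euc n) (c s b : ℝ) :
    ContDiff ℝ 2 (testQuadratic x₀ p q c s b) := by
  unfold testQuadratic
  have h1 : ContDiff ℝ 2 fun x : Euc n => x - x₀ := contDiff_id.sub contDiff_const
  have h2 : ∀ w : Euc n, ContDiff ℝ 2 fun x : Euc n => ⟪w, x - x₀⟫ :=
    fun w => contDiff_const.inner ℝ h1
  exact (contDiff_const.add (h2 p)).add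
    (((contDiff_const.mul ((h2 q).pow 2)).sub (contDiff_const.mul (h1.norm_sq ℝ))).div_const 2)

theorem hess2_testQuadratic {n : ℕ} (x₀ p q : Euc n) (c s b : ℝ) (x : Euc n) :
    hess2 (testQuadratic x₀ p q c s b) x =
      s • Matrix.vecMulVec q.ofLp q.ofLp - b • (1 : Matrix (Fin n) (Fin n) ℝ) := by
  let B : Euc n →L[ℝ] Euc n →L[ℝ] ℝ := LinearMap.toContinuousLinearMap
    { toFun := fun v => innerSL ℝ v
      map_add' := fun v w => map_add _ v w
      map_smul' := fun a v => by ext; simp }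
  have hB : ∀ v w, B v w = ⟪v, w⟫ := fun v w => rfl
  have hid : ∀ y : Euc n, HasFDerivAt (fun x : Euc n => x - x₀) (ContinuousLinearMap.id ℝ _) y :=
    fun y => (hasFDerivAt_id y).sub_const x₀
  have hin : ∀ w y : Euc n, HasFDerivAt (fun x : Euc n => ⟪w, x - x₀⟫) (B w) y :=
    fun w y => (B w).hasFDerivAt.comp y (hid y)
  have hd : fderiv ℝ (testQuadratic x₀ p q c s b) = fun y : Euc n =>
      B p + (s * ⟪q, y - x₀⟫) • B q - b • B (y - x₀) := by
    funext y
    refine HasFDerivAt.fderiv ?_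
    have := ((hin p y).const_add c).add
      (((((hin q y).pow 2).const_mul s).sub ((hid y).norm_sq.const_mul b)).mul_const 2⁻¹)
    refine this.congr_fderiv ?_
    ext z
    simp [hB]
    ring
  have hd2 : ∀ y : Euc n, HasFDerivAt (fderiv ℝ (testQuadratic x₀ p q c s b))
      ((s • B q).smulRight (B q) - b • B) y := fun y => by
    rw [hd]
    exact ((((hin q y).const_mul s).smul_const (B q)).const_add (B p)).sub
      ((B.hasFDerivAt.comp y (hid y)).const_smul b)
  ext i j
  rw [hess2, iteratedFDeriv_two_apply, (hd2 x).fderiv]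
  simp [hB, Matrix.vecMulVec_apply, Matrix.one_apply, EuclideanSpace.inner_single_right, mul_assoc,
    eq_comm]

theorem sq_norm_le_opNorm_vecMulVec {n : ℕ} (q : Euc n) :
    ‖q‖ ^ 2 ≤ opNorm (Matrix.vecMulVec q.ofLp q.ofLp) := by
  rcases eq_or_ne q 0 with rfl | hq
  · simp [opNorm]
  have h1 : Matrix.toEuclideanCLM (𝕜 := ℝ) (Matrix.vecMulVec q.ofLp q.ofLp) q = ‖q‖ ^ 2 • q := by
    ext i
    rw [Matrix.ofLp_toEuclideanCLM, Matrix.vecMulVec_mulVec, EuclideanSpace.real_norm_sq_eq]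
    simp [dotProduct, sq, mul_comm]
  have h2 := (Matrix.toEuclideanCLM (𝕜 := ℝ) (Matrix.vecMulVec q.ofLp q.ofLp)).le_opNorm q
  rw [h1, norm_smul, norm_pow, norm_norm] at h2
  exact le_of_mul_le_mul_right h2 (norm_pos_iff.2 hq)

theorem opNorm_smul_one_le {n : ℕ} {b : ℝ} (hb : 0 ≤ b) :
    opNorm (b • (1 : Matrix (Fin n) (Fin n) ℝ)) ≤ b := by
  rw [opNorm, map_smul, map_one, norm_smul, Real.norm_eq_abs, abs_of_nonneg hb]
  exact mul_le_of_le_one_right hb ContinuousLinearMap.norm_id_le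

theorem posSemidef_vecMulVec_self {n : ℕ} (q : Euc n) :
    (Matrix.vecMulVec q.ofLp q.ofLp).PosSemidef := by
  simpa using Matrix.posSemidef_vecMulVec_self_star q.ofLp

variable {n : ℕ} {F : Matrix (Fin n) (Fin n) ℝ → ℝ} {lb ub : ℝ}

theorem UniformlyElliptic.pos_of_lt (hF : UniformlyElliptic F lb ub) (hF0 : F 0 = 0)
    (hlb : 0 < lb) (hub : 0 ≤ ub) {q : Euc n} {β : ℝ} (hβ : 0 ≤ β) (h : ub / lb * β < ‖q‖ ^ 2) :
    0 < F (Matrix.vecMulVec q.ofLp q.ofLp - β • 1) := by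
  have hone : (β • (1 : Matrix (Fin n) (Fin n) ℝ)).PosSemidef := Matrix.PosSemidef.one.smul hβ
  have h1 := (hF (-(β • 1)) (β • 1) (by simp [Matrix.IsSymm]) hone).2
  have h2 := (hF (-(β • 1)) _ (by simp [Matrix.IsSymm]) (posSemidef_vecMulVec_self q)).1
  rw [neg_add_cancel, hF0] at h1
  rw [neg_add_eq_sub] at h2
  have h3 : ub * opNorm (β • (1 : Matrix (Fin n) (Fin n) ℝ)) ≤ ub * β := by
    gcongr; exact opNorm_smul_one_le hβ
  have h4 : lb * ‖q‖ ^ 2 ≤ lb * opNorm (Matrix.vecMulVec q.ofLp q.ofLp) := by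
    gcongr; exact sq_norm_le_opNorm_vecMulVec q
  have h5 : ub * β < lb * ‖q‖ ^ 2 := by rwa [div_mul_eq_mul_div, div_lt_iff₀' hlb] at h
  linarith

theorem UniformlyElliptic.neg_of_lt (hF : UniformlyElliptic F lb ub) (hF0 : F 0 = 0)
    (hlb : 0 < lb) (hub : 0 ≤ ub) {q : Euc n} {β : ℝ} (hβ : 0 ≤ β) (h : ub / lb * β < ‖q‖ ^ 2) :
    F (β • 1 - Matrix.vecMulVec q.ofLp q.ofLp) < 0 := by
  have hone : (β • (1 : Matrix (Fin n) (Fin n) ℝ)).PosSemidef := Matrix.PosSemidef.one.smul hβ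
  have hsymm : (β • (1 : Matrix (Fin n) (Fin n) ℝ) - Matrix.vecMulVec q.ofLp q.ofLp).IsSymm := by
    simp [Matrix.IsSymm, Matrix.transpose_vecMulVec]
  have h1 := (hF 0 (β • 1) (by simp [Matrix.IsSymm]) hone).2
  have h2 := (hF _ _ hsymm (posSemidef_vecMulVec_self q)).1
  rw [zero_add, hF0] at h1
  rw [sub_add_cancel] at h2
  have h3 : ub * opNorm (β • (1 : Matrix (Fin n) (Fin n) ℝ)) ≤ ub * β := by
    gcongr; exact opNorm_smul_one_le hβ
  have h4 : lb * ‖q‖ ^ 2 ≤ lb * opNorm (Matrix.vecMulVec q.ofLp q.ofLp) := by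
    gcongr; exact sq_norm_le_opNorm_vecMulVec q
  have h5 : ub * β < lb * ‖q‖ ^ 2 := by rwa [div_mul_eq_mul_div, div_lt_iff₀' hlb] at h
  linarith

theorem ViscSupersol.noConvexTouching (hF : UniformlyElliptic F lb ub) (hF0 : F 0 = 0)
    (hlb : 0 < lb) (hub : 0 ≤ ub) {U : Set (Euc n)} {u : Euc n → ℝ} (h : ViscSupersol F U u) :
    NoConvexTouching (ub / lb) U u := by
  intro x₀ hx₀ p q β hβ hq hev
  have h1 := h x₀ hx₀ (testQuadratic x₀ p q (u x₀) 1 β) (contDiff_testQuadratic ..)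
    (by simp [testQuadratic])
    (by filter_upwards [hev] with x hx; simpa [testQuadratic] using hx)
  rw [hess2_testQuadratic, one_smul] at h1
  exact h1.not_gt (hF.pos_of_lt hF0 hlb hub hβ hq)

theorem ViscSubsol.noConvexTouching_neg (hF : UniformlyElliptic F lb ub) (hF0 : F 0 = 0)
    (hlb : 0 < lb) (hub : 0 ≤ ub) {U : Set (Euc n)} {u : Euc n → ℝ} (h : ViscSubsol F U u) :
    NoConvexTouching (ub / lb) U (fun x => -u x) := by
  intro x₀ hx₀ p q β hβ hq hev
  have h1 := h x₀ hx₀ (testQuadratic x₀ (-p) q (u x₀) (-1) (-β)) (contDiff_testQuadratic ..)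
    (by simp [testQuadratic])
    (by
      filter_upwards [hev] with x hx
      simp only [testQuadratic, inner_neg_left]
      linarith)
  rw [hess2_testQuadratic, neg_smul, neg_smul, one_smul, sub_neg_eq_add, neg_add_eq_sub] at h1
  exact h1.not_gt (hF.neg_of_lt hF0 hlb hub hβ hq)

end Viscosity

/-- Growth estimate when the obstacle stays above `φ 0 - M₀`. -/
theorem exists_obstacle_growth (n : ℕ) {lb ub : ℝ} (hlb : 0 < lb) (hle : lb ≤ ub) :
    ∃ C > 0, ∀ (F : Matrix (Fin n) (Fin n) ℝ → ℝ) (Ω : Set (Euc n)) (u φ : Euc n → ℝ) (r M₀ : ℝ),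
      UniformlyElliptic F lb ub → F 0 = 0 → SolvesObstacle F Ω u φ → u 0 = φ 0 → 0 < r →
      ball (0 : Euc n) r ⊆ Ω → (∀ x ∈ ball (0 : Euc n) r, |φ x - φ 0| ≤ M₀) →
      ∀ x ∈ ball (0 : Euc n) (r / 4), u x - u 0 ≤ C * M₀ := by
  obtain ⟨C, hC0, hC⟩ := exists_harnack_quarter (E := Euc n) ((one_le_div hlb).2 hle)
  have hub : 0 ≤ ub := hlb.le.trans hle
  refine ⟨C, hC0, fun F Ω u φ r M₀ hF hF0 ⟨hcont, hge, hsup, _, hsub⟩ hu0 hr hball hM₀ x hx => ?_⟩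
  have hM₀0 : 0 ≤ M₀ := (abs_nonneg _).trans (hM₀ 0 (mem_ball_self hr))
  have key : ∀ M, M₀ < M → u x - u 0 ≤ C * M := by
    intro M hM
    have hMpos : 0 < M := hM₀0.trans_lt hM
    have hinv : 0 < M⁻¹ := inv_pos.2 hMpos
    have e : ∀ y, M⁻¹ * u y + (1 - M⁻¹ * u 0) = M⁻¹ * (u y - u 0 + M) := fun y => by
      field_simp; ring
    have h := hC r (fun y => M⁻¹ * u y + (1 - M⁻¹ * u 0)) hr
      (((hcont.mono hball).const_mul _).add continuousOn_const) ?_ ?_ ?_ ?_ x hx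
    · simp only [e] at h
      rw [inv_mul_le_iff₀ hMpos] at h
      linarith [mul_comm M C]
    · simpa using ((hsup.noConvexTouching hF hF0 hlb hub).mono hball).rescale 0 one_pos hinv
        (1 - M⁻¹ * u 0)
    · intro y hy
      have h1 := hge y (hball hy)
      have h2 := (abs_le.1 (hM₀ y hy)).1
      simp only [e]
      exact mul_nonneg hinv.le (by linarith)
    · simp
    · have h1 := ((hsub.noConvexTouching_neg hF hF0 hlb hub).rescale 0 one_pos hinv
        (-(1 - M⁻¹ * u 0))).mono
          (U := ball 0 r ∩ {y | 2 < M⁻¹ * u y + (1 - M⁻¹ * u 0)}) ?_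
      · convert h1 using 2
        simp only [one_smul, zero_add]
        ring
      · rintro y ⟨hy, hy2 : 2 < M⁻¹ * u y + (1 - M⁻¹ * u 0)⟩
        have h2 := (abs_le.1 (hM₀ y hy)).2
        rw [e, lt_inv_mul_iff₀ hMpos] at hy2
        simp only [one_smul, zero_add, preimage_id']
        exact ⟨hball hy, by linarith⟩
  refine (div_le_iff₀' hC0).1 (le_of_forall_gt_imp_ge_of_dense fun M hM => ?_)
  exact (div_le_iff₀' hC0).2 (key M hM)

/-- Growth of the solution away from a free boundary point is controlled
by the modulus of continuity of the obstacle, with a constant depending only on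
`n`, `λ`, `Λ`; in particular a Lipschitz obstacle gives linear growth. -/
theorem obstacle_growth_from_free_boundary
    (n : ℕ) (lb ub : ℝ) (hlb : 0 < lb) (hle : lb ≤ ub) :
    ∃ C > 0, ∀ (F : Matrix (Fin n) (Fin n) ℝ → ℝ) (Ω : Set (Euc n)) (u φ : Euc n → ℝ)
      (r : ℝ),
      UniformlyElliptic F lb ub → F 0 = 0 → IsOpen Ω →
      SolvesObstacle F Ω u φ →
      (0 : Euc n) ∈ Ω → u 0 = φ 0 → (0 : Euc n) ∈ frontier {x ∈ Ω | φ x < u x} →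
      0 < r → ball (0 : Euc n) r ⊆ Ω →
      (∀ γ : ℝ → ℝ, MonotoneOn γ (Ici 0) →
        (∀ x ∈ ball (0 : Euc n) r, ∀ y ∈ ball (0 : Euc n) r, |φ x - φ y| ≤ γ ‖x - y‖) →
        ∀ x ∈ ball (0 : Euc n) (r / 4), u x - u 0 ≤ C * γ r) ∧
      (∀ L : ℝ, 0 ≤ L →
        (∀ x ∈ ball (0 : Euc n) r, ∀ y ∈ ball (0 : Euc n) r, |φ x - φ y| ≤ L * ‖x - y‖) →
        ∀ x ∈ ball (0 : Euc n) (r / 4), u x - u 0 ≤ C * L * r) := by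
  obtain ⟨C, hC0, hC⟩ := exists_obstacle_growth n hlb hle
  refine ⟨C, hC0, fun F Ω u φ r hF hF0 _ hu _ hu0 _ hr hball => ⟨fun γ hγ hφ => ?_, fun L hL hφ => ?_⟩⟩
  · refine hC F Ω u φ r (γ r) hF hF0 hu hu0 hr hball fun x hx => ?_
    have h1 := hφ x hx 0 (mem_ball_self hr)
    rw [sub_zero] at h1
    exact h1.trans (hγ (norm_nonneg x) hr.le (mem_ball_zero_iff.1 hx).le)
  · rw [mul_assoc]
    refine hC F Ω u φ r (L * r) hF hF0 hu hu0 hr hball fun x hx => ?_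
    have h1 := hφ x hx 0 (mem_ball_self hr)
    rw [sub_zero] at h1
    exact h1.trans (mul_le_mul_of_nonneg_left (mem_ball_zero_iff.1 hx).le hL)
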